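/- Let n ≥ 1, let U ⊆ ℝ² be open, and let H, P₊, P₋ : U → M_n(ℂ) and ε₊, ε₋ : U → ℝ all be differentiable at a point x₀ ∈ U, satisfying at every x ∈ U: H(x) is Hermitian, P₊(x) and P₋(x) are Hermitian, P₊(x)² = P₊(x), P₋(x)² = P₋(x), P₊(x) + P₋(x) = I, P₊(x)P₋(x) = 0, H(x)P₊(x) = ε₊(x)P₊(x), and H(x)P₋(x) = ε₋(x)P₋(x). Then at x₀, for all i, j ∈ {1,2}: Tr( P₋ ∂ᵢH P₊ ∂ⱼH ) = (ε₊ − ε₋)² · Tr( P₋ ∂ᵢP₋ ∂ⱼP₋ ). -/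

import Mathlib

noncomputable section
open Matrix

/-- Partial derivative in the `i`-th coordinate direction of a function `f : ℝ² → E`. -/
def pd {E : Type*} [NormedAddCommGroup E] [NormedSpace ℝ E]
    (i : Fin 2) (f : EuclideanSpace ℝ (Fin 2) → E) (x : EuclideanSpace ℝ (Fin 2)) : E :=
  fderiv ℝ f x (EuclideanSpace.single i 1)

/-- Entrywise partial derivative of a matrix-valued function. -/
def pdM {n : ℕ} (i : Fin 2) (P : EuclideanSpace ℝ (Fin 2) → Matrix (Fin n) (Fin n) ℂ)
    (x : EuclideanSpace ℝ (Fin 2)) : Matrix (Fin n) (Fin n) ℂ :=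
  Matrix.of fun a b => pd i (fun y => P y a b) x

section PartialDerivatives

variable {n : ℕ} {i : Fin 2} {A B : EuclideanSpace ℝ (Fin 2) → Matrix (Fin n) (Fin n) ℂ}
  {x : EuclideanSpace ℝ (Fin 2)}

theorem pdM_congr (h : A =ᶠ[nhds x] B) : pdM i A x = pdM i B x := by
  ext a b
  have hab : (fun y => A y a b) =ᶠ[nhds x] fun y => B y a b := by
    filter_upwards [h] with y hy
    rw [hy]
  simp only [pdM, pd, Matrix.of_apply, hab.fderiv_eq]

theorem pdM_const (C : Matrix (Fin n) (Fin n) ℂ) : pdM i (fun _ => C) x = 0 := by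
  ext a b
  simp [pdM, pd]

theorem pdM_add (hA : ∀ a b, DifferentiableAt ℝ (fun y => A y a b) x)
    (hB : ∀ a b, DifferentiableAt ℝ (fun y => B y a b) x) :
    pdM i (fun y => A y + B y) x = pdM i A x + pdM i B x := by
  ext a b
  simp only [pdM, pd, Matrix.of_apply, Matrix.add_apply]
  rw [fderiv_fun_add (hA a b) (hB a b)]
  rfl

theorem pdM_mul (hA : ∀ a b, DifferentiableAt ℝ (fun y => A y a b) x)
    (hB : ∀ a b, DifferentiableAt ℝ (fun y => B y a b) x) :
    pdM i (fun y => A y * B y) x = A x * pdM i B x + pdM i A x * B x := by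
  ext a b
  simp only [pdM, pd, Matrix.of_apply, Matrix.add_apply, Matrix.mul_apply]
  rw [fderiv_fun_sum fun k _ => (hA a k).fun_mul (hB k b), _root_.sum_apply,
    ← Finset.sum_add_distrib]
  refine Finset.sum_congr rfl fun k _ => ?_
  rw [fderiv_fun_mul (hA a k) (hB k b)]
  simp [mul_comm]

theorem pdM_ofReal_smul {f : EuclideanSpace ℝ (Fin 2) → ℝ} (hf : DifferentiableAt ℝ f x)
    (hA : ∀ a b, DifferentiableAt ℝ (fun y => A y a b) x) :
    pdM i (fun y => (f y : ℂ) • A y) x = (f x : ℂ) • pdM i A x + ((pd i f x : ℝ) : ℂ) • A x := by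
  ext a b
  simp only [pdM, pd, Matrix.of_apply, Matrix.add_apply, Matrix.smul_apply]
  simp only [Complex.coe_smul]
  rw [fderiv_fun_smul hf (hA a b)]
  simp

end PartialDerivatives

/-- The off-diagonal blocks of `dH = p dP + dp P + m dQ + dm Q` for complementary projections
`P = 1 - Q` and `Q`, where `dP = -dQ`. -/
theorem offDiagonal_blocks {n : ℕ} {P Q dP dQ dH : Matrix (Fin n) (Fin n) ℂ} {p m dp dm : ℂ}
    (hPP : P * P = P) (hQQ : Q * Q = Q) (hPQ : P * Q = 0) (hQP : Q * P = 0)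
    (hsum : P + Q = 1) (hdsum : dP + dQ = 0) (hdQ : Q * dQ + dQ * Q = dQ)
    (hdH : dH = (p • dP + dp • P) + (m • dQ + dm • Q)) :
    Q * dH * P = (m - p) • (Q * dQ) ∧ P * dH * Q = (m - p) • (dQ * Q) := by
  obtain rfl : P = 1 - Q := eq_sub_of_add_eq hsum
  obtain rfl : dP = -dQ := eq_neg_of_add_eq_zero_left hdsum
  have h0 : Q * dQ * Q = 0 := by
    have h := congrArg (Q * ·) hdQ
    simp only [mul_add, ← mul_assoc, hQQ] at h
    simpa using h
  have h1 : Q * dQ * (1 - Q) = Q * dQ := by rw [mul_sub, h0, mul_one, sub_zero]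
  have h2 : (1 - Q) * dQ * Q = dQ * Q := by rw [sub_mul, sub_mul, h0, one_mul, sub_zero]
  subst hdH
  constructor
  · simp only [mul_add, add_mul, Matrix.mul_smul, Matrix.smul_mul, hQP, hQQ, mul_neg, neg_mul, h1]
    simp only [zero_mul, smul_zero]
    module
  · simp only [mul_add, add_mul, Matrix.mul_smul, Matrix.smul_mul, hPQ, hPP, mul_neg, neg_mul, h2]
    simp only [zero_mul, smul_zero]
    module

/-- For a differentiable family of Hermitian matrices with two spectral
branches `ε₊, ε₋` and spectral projections `P₊, P₋`, one has, at the point of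
differentiability, `Tr(P₋ ∂ᵢH P₊ ∂ⱼH) = (ε₊ − ε₋)² Tr(P₋ ∂ᵢP₋ ∂ⱼP₋)` for `i, j ∈ {1,2}`. -/
theorem vertex_trace_eq_berry_trace {n : ℕ} (hn : 1 ≤ n)
    (U : Set (EuclideanSpace ℝ (Fin 2))) (hU : IsOpen U)
    (H Pp Pm : EuclideanSpace ℝ (Fin 2) → Matrix (Fin n) (Fin n) ℂ)
    (εp εm : EuclideanSpace ℝ (Fin 2) → ℝ)
    (x₀ : EuclideanSpace ℝ (Fin 2)) (hx₀ : x₀ ∈ U)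
    (hHdiff : ∀ a b, DifferentiableAt ℝ (fun x => H x a b) x₀)
    (hPpdiff : ∀ a b, DifferentiableAt ℝ (fun x => Pp x a b) x₀)
    (hPmdiff : ∀ a b, DifferentiableAt ℝ (fun x => Pm x a b) x₀)
    (hεpdiff : DifferentiableAt ℝ εp x₀) (hεmdiff : DifferentiableAt ℝ εm x₀)
    (hH : ∀ x ∈ U, (H x).IsHermitian)
    (hPpH : ∀ x ∈ U, (Pp x).IsHermitian) (hPmH : ∀ x ∈ U, (Pm x).IsHermitian)
    (hPp2 : ∀ x ∈ U, Pp x * Pp x = Pp x) (hPm2 : ∀ x ∈ U, Pm x * Pm x = Pm x)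
    (hsum : ∀ x ∈ U, Pp x + Pm x = 1)
    (horth : ∀ x ∈ U, Pp x * Pm x = 0)
    (hHp : ∀ x ∈ U, H x * Pp x = (εp x : ℂ) • Pp x)
    (hHm : ∀ x ∈ U, H x * Pm x = (εm x : ℂ) • Pm x) :
    ∀ i j : Fin 2,
      Matrix.trace (Pm x₀ * pdM i H x₀ * Pp x₀ * pdM j H x₀) =
        (((εp x₀ - εm x₀ : ℝ) : ℂ)) ^ 2 *
          Matrix.trace (Pm x₀ * pdM i Pm x₀ * pdM j Pm x₀) := by
  have hnhds : ∀ᶠ x in nhds x₀, x ∈ U := hU.mem_nhds hx₀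
  have hεP : ∀ {ε : EuclideanSpace ℝ (Fin 2) → ℝ}
      {P : EuclideanSpace ℝ (Fin 2) → Matrix (Fin n) (Fin n) ℂ}, DifferentiableAt ℝ ε x₀ →
      (∀ a b, DifferentiableAt ℝ (fun x => P x a b) x₀) →
      ∀ a b, DifferentiableAt ℝ (fun x => ((ε x : ℂ) • P x) a b) x₀ := by
    intro ε P hε hP a b
    simpa only [Matrix.smul_apply, Complex.coe_smul] using hε.fun_smul (hP a b)
  have hQP : Pm x₀ * Pp x₀ = 0 := by
    rw [← add_sub_cancel_left (Pp x₀) (Pm x₀), hsum x₀ hx₀, sub_mul, one_mul, hPp2 x₀ hx₀, sub_self]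
  have hdsum (k : Fin 2) : pdM k Pp x₀ + pdM k Pm x₀ = 0 := by
    rw [← pdM_add hPpdiff hPmdiff, ← pdM_const (i := k) (x := x₀) (1 : Matrix (Fin n) (Fin n) ℂ)]
    exact pdM_congr (hnhds.mono hsum)
  have hdQ (k : Fin 2) : Pm x₀ * pdM k Pm x₀ + pdM k Pm x₀ * Pm x₀ = pdM k Pm x₀ := by
    rw [← pdM_mul hPmdiff hPmdiff]
    exact pdM_congr (hnhds.mono hPm2)
  have hdH (k : Fin 2) : pdM k H x₀ =
      ((εp x₀ : ℂ) • pdM k Pp x₀ + ((pd k εp x₀ : ℝ) : ℂ) • Pp x₀) +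
        ((εm x₀ : ℂ) • pdM k Pm x₀ + ((pd k εm x₀ : ℝ) : ℂ) • Pm x₀) := by
    rw [← pdM_ofReal_smul hεpdiff hPpdiff, ← pdM_ofReal_smul hεmdiff hPmdiff,
      ← pdM_add (hεP hεpdiff hPpdiff) (hεP hεmdiff hPmdiff)]
    refine pdM_congr (hnhds.mono fun x hx => ?_)
    beta_reduce
    rw [← hHp x hx, ← hHm x hx, ← mul_add, hsum x hx, mul_one]
  have hblocks (k : Fin 2) := offDiagonal_blocks (hPp2 x₀ hx₀) (hPm2 x₀ hx₀) (horth x₀ hx₀) hQP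
    (hsum x₀ hx₀) (hdsum k) (hdQ k) (hdH k)
  intro i j
  calc Matrix.trace (Pm x₀ * pdM i H x₀ * Pp x₀ * pdM j H x₀)
      = Matrix.trace ((Pm x₀ * pdM i H x₀ * Pp x₀) * (Pp x₀ * pdM j H x₀ * Pm x₀)) := by
        rw [← mul_assoc, Matrix.trace_mul_comm _ (Pm x₀)]
        simp only [← mul_assoc, hPm2 x₀ hx₀]
        rw [mul_assoc _ (Pp x₀) (Pp x₀), hPp2 x₀ hx₀]
    _ = ((εp x₀ - εm x₀ : ℝ) : ℂ) ^ 2 *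
          Matrix.trace ((Pm x₀ * pdM i Pm x₀) * (pdM j Pm x₀ * Pm x₀)) := by
        rw [(hblocks i).1, (hblocks j).2, Matrix.smul_mul, Matrix.mul_smul, Matrix.trace_smul,
          Matrix.trace_smul, smul_eq_mul, smul_eq_mul]
        push_cast
        ring
    _ = ((εp x₀ - εm x₀ : ℝ) : ℂ) ^ 2 *
          Matrix.trace (Pm x₀ * pdM i Pm x₀ * pdM j Pm x₀) := by
        rw [← mul_assoc, Matrix.trace_mul_comm _ (Pm x₀)]
        simp only [← mul_assoc, hPm2 x₀ hx₀]
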